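/- The Eulerian ideal I(G) is generated by the set {t_e² − t_ℓ² : e, ℓ ∈ E_G} together with the set of all Eulerian binomials, i.e. all binomials t_J − t_K where C ⊆ E_G is an Eulerian set of even cardinality and C = J ⊔ K is a partition of C into two sets of equal cardinality. -/

import Mathlib

open MvPolynomial Finset

variable {n : ℕ}

/-- The monomial `x_i * x_j` attached to an edge `{i,j}`. -/
noncomputable def edgeMono (K : Type*) [Field K] (e : Sym2 (Fin n)) :
    MvPolynomial (Fin n) K :=
  Sym2.lift ⟨fun i j => X i * X j, fun _ _ => mul_comm _ _⟩ e

/-- The map `φ : K[E_G] → K[x_1,…,x_n]`, `t_e ↦ x_i x_j` for `e = {i,j}`. -/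
noncomputable def phiG (K : Type*) [Field K] (G : SimpleGraph (Fin n)) :
    MvPolynomial G.edgeSet K →ₐ[K] MvPolynomial (Fin n) K :=
  aeval (fun e => edgeMono K e.1)

/-- The Eulerian ideal `I(G) = φ⁻¹(x_i² - x_j² : i, j)`. -/
noncomputable def eulerianIdeal (K : Type*) [Field K] (G : SimpleGraph (Fin n)) :
    Ideal (MvPolynomial G.edgeSet K) :=
  Ideal.comap (phiG K G) (Ideal.span {f | ∃ i j : Fin n, f = X i ^ 2 - X j ^ 2})

/-- `deg_J(i)`: the number of edges of `J` containing the vertex `i`. -/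
def degIn (G : SimpleGraph (Fin n)) (J : Finset G.edgeSet) (i : Fin n) : ℕ :=
  (J.filter fun e => i ∈ e.val).card

/-- A set of edges is Eulerian if every vertex has even degree in it. -/
def IsEulerianSet (G : SimpleGraph (Fin n)) (C : Finset G.edgeSet) : Prop :=
  ∀ i : Fin n, Even (degIn G C i)

/-- `J` is a `T`-join. -/
def IsTJoin (G : SimpleGraph (Fin n)) (T : Finset (Fin n)) (J : Finset G.edgeSet) : Prop :=
  ∀ i : Fin n, i ∈ T ↔ Odd (degIn G J i)

/-- `J` is a `(T,p)`-join. -/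
def IsTPJoin (G : SimpleGraph (Fin n)) (T : Finset (Fin n)) (p : ZMod 2)
    (J : Finset G.edgeSet) : Prop :=
  IsTJoin G T J ∧ (J.card : ZMod 2) = p

/-- `(T,p) ∈ 𝒯_G`: there exists a `(T,p)`-join. -/
def JoinExists (G : SimpleGraph (Fin n)) (T : Finset (Fin n)) (p : ZMod 2) : Prop :=
  ∃ J : Finset G.edgeSet, IsTPJoin G T p J

/-- `J ∈ 𝒥(T,p)`: `J` is a `(T,p)`-join of minimum cardinality. -/
def IsMinJoin (G : SimpleGraph (Fin n)) (T : Finset (Fin n)) (p : ZMod 2)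
    (J : Finset G.edgeSet) : Prop :=
  IsTPJoin G T p J ∧ ∀ J' : Finset G.edgeSet, IsTPJoin G T p J' → J.card ≤ J'.card

/-- The equivalence relation `∼` on minimum cardinality `(T,p)`-joins. -/
def JoinEquiv (G : SimpleGraph (Fin n)) (T : Finset (Fin n)) (p : ZMod 2)
    (J K : Finset G.edgeSet) : Prop :=
  ∃ (r : ℕ) (L : ℕ → Finset G.edgeSet), L 0 = J ∧ L r = K ∧
    (∀ i ≤ r, IsMinJoin G T p (L i)) ∧ ∀ i < r, (L i ∩ L (i + 1)).Nonempty

/-- `(T,p) ∈ 𝒯_G*`: there are two nonequivalent minimum cardinality `(T,p)`-joins. -/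
def TGstar (G : SimpleGraph (Fin n)) (T : Finset (Fin n)) (p : ZMod 2) : Prop :=
  ∃ J K : Finset G.edgeSet, IsMinJoin G T p J ∧ IsMinJoin G T p K ∧ ¬ JoinEquiv G T p J K

/-- `t_J`, the product of the variables indexed by the edges of `J`. -/
noncomputable def tMon (K : Type*) [Field K] (G : SimpleGraph (Fin n))
    (J : Finset G.edgeSet) : MvPolynomial G.edgeSet K :=
  ∏ e ∈ J, X e

/-- The vertex set of a set of edges. -/
def edgeVerts (G : SimpleGraph (Fin n)) (C : Finset G.edgeSet) : Finset (Fin n) :=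
  Finset.univ.filter fun i => ∃ e ∈ C, i ∈ e.val

/-- `C` is the edge set of a cycle of `G`. -/
def IsCycleSet (G : SimpleGraph (Fin n)) (C : Finset G.edgeSet) : Prop :=
  ∃ (v : Fin n) (w : G.Walk v v), w.IsCycle ∧
    C.image (fun e => e.val) = w.edges.toFinset

/-- A chord of a cycle `C`: an edge of `G` joining two nonadjacent vertices of `C`. -/
def IsChord (G : SimpleGraph (Fin n)) (C : Finset G.edgeSet) (l : G.edgeSet) : Prop :=
  l ∉ C ∧ ∀ i ∈ l.val, i ∈ edgeVerts G C

/-- An even-chord of an even cardinality Eulerian set `C`. -/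
def IsEvenChord (G : SimpleGraph (Fin n)) (C : Finset G.edgeSet) (l : G.edgeSet) : Prop :=
  l ∉ C ∧ ∃ C₁ C₂ : Finset G.edgeSet,
    IsEulerianSet G C₁ ∧ Even C₁.card ∧ IsEulerianSet G C₂ ∧ Even C₂.card ∧
    C₁ ∩ C₂ = {l} ∧ C = symmDiff C₁ C₂

/-- `S` is a minimal homogeneous generating set of the ideal `I`. -/
def IsMinimalHomGenSet {σ K : Type*} [Field K] (S : Set (MvPolynomial σ K))
    (I : Ideal (MvPolynomial σ K)) : Prop :=
  (∀ f ∈ S, ∃ d : ℕ, f.IsHomogeneous d) ∧ Ideal.span S = I ∧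
    ∀ f ∈ S, Ideal.span (S \ {f}) ≠ I


/-- Modulo an ideal identifying the squares of all variables, a monomial depends only on its
degree and on the parities of its exponents. -/
lemma monomial_sub_monomial_mem_of_sq {σ K : Type*} [Fintype σ] [Field K]
    {I : Ideal (MvPolynomial σ K)} (hI : ∀ i j, X i ^ 2 - X j ^ 2 ∈ I) {u v : σ →₀ ℕ}
    (hdeg : ∑ i, u i = ∑ i, v i) (hpar : ∀ i, u i % 2 = v i % 2) :
    monomial u (1 : K) - monomial v 1 ∈ I := by
  rcases isEmpty_or_nonempty σ with hσ | ⟨⟨i₀⟩⟩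
  · simp [Subsingleton.elim u v]
  have hsq : ∀ i, Ideal.Quotient.mk I (X i) ^ 2 = Ideal.Quotient.mk I (X i₀) ^ 2 := fun i => by
    simpa using Ideal.Quotient.eq.2 (hI i i₀)
  have key : ∀ w : σ →₀ ℕ, Ideal.Quotient.mk I (monomial w (1 : K)) =
      (Ideal.Quotient.mk I (X i₀) ^ 2) ^ (∑ i, w i / 2) *
        ∏ i, Ideal.Quotient.mk I (X i) ^ (w i % 2) := fun w => by
    rw [monomial_eq, Finsupp.prod_fintype _ _ (by simp), C_1, one_mul, map_prod,
      ← Finset.prod_pow_eq_pow_sum, ← Finset.prod_mul_distrib]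
    refine Finset.prod_congr rfl fun i _ => ?_
    rw [← hsq i, ← pow_mul, ← pow_add, Nat.div_add_mod, map_pow]
  have hhalf : ∑ i, u i / 2 = ∑ i, v i / 2 := by
    have hu : ∑ i, u i = 2 * ∑ i, u i / 2 + ∑ i, u i % 2 := by
      rw [Finset.mul_sum, ← Finset.sum_add_distrib]
      exact Finset.sum_congr rfl fun i _ => (Nat.div_add_mod _ _).symm
    have hv : ∑ i, v i = 2 * ∑ i, v i / 2 + ∑ i, v i % 2 := by
      rw [Finset.mul_sum, ← Finset.sum_add_distrib]
      exact Finset.sum_congr rfl fun i _ => (Nat.div_add_mod _ _).symm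
    have huv : ∑ i, u i % 2 = ∑ i, v i % 2 := Finset.sum_congr rfl fun i _ => hpar i
    omega
  rw [← Ideal.Quotient.eq, key, key, hhalf]
  simp only [hpar]

/-- If an algebra homomorphism sends monomials to basis elements, its kernel is contained in every
ideal containing the differences of monomials with the same image. -/
lemma mem_of_map_eq_zero_of_monomial_sub_mem {σ K M : Type*} [Field K] [AddCommMonoid M]
    {g : (σ →₀ ℕ) → M} {Ψ : MvPolynomial σ K →ₐ[K] AddMonoidAlgebra K M}
    (hΨ : ∀ a, Ψ (monomial a 1) = AddMonoidAlgebra.single (g a) 1)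
    {I : Ideal (MvPolynomial σ K)}
    (hI : ∀ a b, g a = g b → monomial a (1 : K) - monomial b 1 ∈ I)
    {f : MvPolynomial σ K} (hf : Ψ f = 0) : f ∈ I := by
  let L : AddMonoidAlgebra K M →ₗ[K] MvPolynomial σ K :=
    Finsupp.linearCombination K (fun q => monomial (Function.invFun g q) (1 : K)) ∘ₗ
      (AddMonoidAlgebra.coeffLinearEquiv K).toLinearMap
  suffices h : f - L (Ψ f) ∈ I by simpa [hf] using h
  clear hf
  induction f using MvPolynomial.induction_on' with
  | monomial u c =>
    have hu : monomial u c = c • monomial u (1 : K) := by simp [smul_monomial]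
    have hL : L (AddMonoidAlgebra.single (g u) 1) =
        monomial (Function.invFun g (g u)) (1 : K) := by
      simp [L, AddMonoidAlgebra.coeffLinearEquiv]
    rw [hu, map_smul, hΨ, map_smul, hL, ← smul_sub]
    exact Submodule.smul_of_tower_mem I c (hI _ _ (Function.invFun_eq ⟨u, rfl⟩).symm)
  | add p q hp hq =>
    rw [map_add, map_add, add_sub_add_comm]
    exact I.add_mem hp hq

/-- The exponent vector of `edgeMono`. -/
noncomputable def edgeExp (e : Sym2 (Fin n)) : Fin n →₀ ℕ :=
  Finsupp.equivFunOnFinite.symm fun i => if i ∈ e then 1 else 0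

@[simp]
lemma edgeExp_apply (e : Sym2 (Fin n)) (i : Fin n) : edgeExp e i = if i ∈ e then 1 else 0 := rfl

lemma edgeExp_mk {i j : Fin n} (h : i ≠ j) :
    edgeExp s(i, j) = Finsupp.single i 1 + Finsupp.single j 1 := by
  ext k
  by_cases hi : i = k <;> by_cases hj : j = k <;>
    simp_all [eq_comm]

lemma edgeMono_eq_monomial (K : Type*) [Field K] {e : Sym2 (Fin n)} (he : ¬ e.IsDiag) :
    edgeMono K e = monomial (edgeExp e) 1 := by
  induction e with
  | _ i j =>
    rw [edgeExp_mk (by simpa using he)]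
    simp [edgeMono, X, monomial_mul]

lemma sum_edgeExp {e : Sym2 (Fin n)} (he : ¬ e.IsDiag) : ∑ i, edgeExp e i = 2 := by
  induction e with
  | _ i j =>
    rw [edgeExp_mk (by simpa using he)]
    simp [Finset.sum_add_distrib, Finsupp.single_apply]

lemma phiG_tMon (K : Type*) [Field K] (G : SimpleGraph (Fin n)) (J : Finset G.edgeSet) :
    phiG K G (tMon K G J) = monomial (∑ e ∈ J, edgeExp e.1) 1 := by
  rw [tMon, map_prod, monomial_sum_one]
  refine Finset.prod_congr rfl fun e _ => ?_
  rw [phiG, aeval_X, edgeMono_eq_monomial K (G.not_isDiag_of_mem_edgeSet e.2)]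

lemma sum_edgeExp_apply (G : SimpleGraph (Fin n)) (J : Finset G.edgeSet) (i : Fin n) :
    (∑ e ∈ J, edgeExp e.1) i = degIn G J i := by
  rw [Finsupp.finsetSum_apply, degIn, Finset.card_filter]
  rfl

lemma sum_sum_edgeExp (G : SimpleGraph (Fin n)) (J : Finset G.edgeSet) :
    ∑ i, (∑ e ∈ J, edgeExp e.1) i = 2 * J.card := by
  simp_rw [Finsupp.finsetSum_apply]
  rw [Finset.sum_comm, Finset.sum_congr rfl fun e _ =>
    sum_edgeExp (G.not_isDiag_of_mem_edgeSet e.2)]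
  simp [mul_comm]

lemma degIn_union {G : SimpleGraph (Fin n)} {J L : Finset G.edgeSet} (h : Disjoint J L)
    (i : Fin n) : degIn G (J ∪ L) i = degIn G J i + degIn G L i := by
  rw [degIn, Finset.filter_union, Finset.card_union_of_disjoint (Finset.disjoint_filter_filter h)]
  rfl

/-- Two variables of the edge ring have squares congruent modulo the Eulerian ideal. -/
lemma sq_sub_sq_mem_eulerianIdeal (K : Type*) [Field K] (G : SimpleGraph (Fin n))
    (e l : G.edgeSet) : X e ^ 2 - X l ^ 2 ∈ eulerianIdeal K G := by
  have h : ∀ e : G.edgeSet, phiG K G (X e ^ 2) = monomial (2 • edgeExp e.1) 1 := fun e => by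
    rw [map_pow, phiG, aeval_X, edgeMono_eq_monomial K (G.not_isDiag_of_mem_edgeSet e.2),
      monomial_pow, one_pow]
  rw [eulerianIdeal, Ideal.mem_comap, map_sub, h, h]
  refine monomial_sub_monomial_mem_of_sq (fun i j => Ideal.subset_span (Set.mem_ofPred.2 ⟨i, j, rfl⟩)) ?_ ?_
  · simp only [Finsupp.smul_apply, ← Finset.smul_sum,
      sum_edgeExp (G.not_isDiag_of_mem_edgeSet e.2), sum_edgeExp (G.not_isDiag_of_mem_edgeSet l.2)]
  · intro i
    simp only [Finsupp.smul_apply, smul_eq_mul, Nat.mul_mod_right]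

/-- Eulerian binomials belong to the Eulerian ideal. -/
lemma tMon_sub_tMon_mem_eulerianIdeal (K : Type*) [Field K] {G : SimpleGraph (Fin n)}
    {J L : Finset G.edgeSet} (hE : IsEulerianSet G (J ∪ L)) (hJL : Disjoint J L)
    (hcard : J.card = L.card) : tMon K G J - tMon K G L ∈ eulerianIdeal K G := by
  rw [eulerianIdeal, Ideal.mem_comap, map_sub, phiG_tMon, phiG_tMon]
  refine monomial_sub_monomial_mem_of_sq (fun i j => Ideal.subset_span (Set.mem_ofPred.2 ⟨i, j, rfl⟩)) ?_ fun i => ?_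
  · rw [sum_sum_edgeExp, sum_sum_edgeExp, hcard]
  · have h := hE i
    rw [degIn_union hJL, Nat.even_iff] at h
    rw [sum_edgeExp_apply, sum_edgeExp_apply]
    omega

lemma aeval_single_monomial {σ K M : Type*} [Field K] [AddCommMonoid M] (c : σ → M)
    (a : σ →₀ ℕ) :
    aeval (fun i => AddMonoidAlgebra.single (c i) (1 : K)) (monomial a (1 : K)) =
      AddMonoidAlgebra.single (a.sum fun i k => k • c i) 1 := by
  classical
  induction a using Finsupp.induction_linear with
  | zero => rw [monomial_zero', C_1, map_one, Finsupp.sum_zero_index, AddMonoidAlgebra.one_def]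
  | add f g hf hg =>
    rw [← mul_one (1 : K), ← monomial_mul, map_mul, mul_one, hf, hg,
      AddMonoidAlgebra.single_mul_single, mul_one,
      Finsupp.sum_add_index (by simp) (by simp [add_smul])]
  | single i k => simp [← X_pow_eq_monomial, AddMonoidAlgebra.single_pow]

/-- The class of a monomial in the variables `x_i` modulo the ideal of differences of squares: its
degree together with the parities of its exponents. -/
noncomputable def parityMap (K : Type*) [Field K] (n : ℕ) :
    MvPolynomial (Fin n) K →ₐ[K] AddMonoidAlgebra K (ℕ × (Fin n → ZMod 2)) :=
  aeval fun i => AddMonoidAlgebra.single (1, Pi.single i 1) 1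

lemma parityMap_eq_zero {K : Type*} [Field K] {f : MvPolynomial (Fin n) K}
    (hf : f ∈ Ideal.span {f : MvPolynomial (Fin n) K | ∃ i j : Fin n, f = X i ^ 2 - X j ^ 2}) :
    parityMap K n f = 0 := by
  have h : ∀ i : Fin n, 2 • (Pi.single i 1 : Fin n → ZMod 2) = 0 := fun i => by
    rw [← Nat.cast_smul_eq_nsmul (ZMod 2)]
    simp [show (2 : ZMod 2) = 0 from rfl]
  rw [← RingHom.mem_ker]
  refine Ideal.span_le.2 ?_ hf
  rintro _ ⟨i, j, rfl⟩
  simp only [SetLike.mem_coe, RingHom.mem_ker, parityMap, map_sub, map_pow, aeval_X,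
    AddMonoidAlgebra.single_pow, Prod.smul_mk, h, sub_self]

/-- The degree and the vertex parities of the image of an edge variable. -/
def edgeClass (e : Sym2 (Fin n)) : ℕ × (Fin n → ZMod 2) :=
  (2, fun i => if i ∈ e then 1 else 0)

lemma parityMap_edgeMono (K : Type*) [Field K] {e : Sym2 (Fin n)} (he : ¬ e.IsDiag) :
    parityMap K n (edgeMono K e) = AddMonoidAlgebra.single (edgeClass e) 1 := by
  induction e with
  | _ i j =>
    have hij : i ≠ j := by simpa using he
    have h : edgeClass s(i, j) =
        ((1, Pi.single i 1) + (1, Pi.single j 1) : ℕ × (Fin n → ZMod 2)) := by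
      refine Prod.ext rfl (funext fun k => ?_)
      by_cases hi : k = i <;> by_cases hj : k = j <;> simp_all [edgeClass]
    rw [h]
    simp [edgeMono, parityMap, AddMonoidAlgebra.single_mul_single]

lemma parityMap_phiG_monomial (K : Type*) [Field K] (G : SimpleGraph (Fin n))
    (a : G.edgeSet →₀ ℕ) :
    (parityMap K n).comp (phiG K G) (monomial a 1) =
      AddMonoidAlgebra.single (a.sum fun e k => k • edgeClass e.1) 1 := by
  rw [← aeval_single_monomial]
  congr 1
  refine MvPolynomial.algHom_ext fun e => ?_
  simp [phiG, parityMap_edgeMono K (G.not_isDiag_of_mem_edgeSet e.2)]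

lemma tMon_eq_monomial (K : Type*) [Field K] (G : SimpleGraph (Fin n)) (J : Finset G.edgeSet) :
    tMon K G J = monomial (∑ e ∈ J, Finsupp.single e 1) 1 := by
  rw [tMon, monomial_sum_one]
  rfl

lemma sum_single_one_apply {σ : Type*} [DecidableEq σ] (J : Finset σ) (x : σ) :
    (∑ e ∈ J, Finsupp.single e 1) x = if x ∈ J then 1 else 0 := by
  simp [Finsupp.finsetSum_apply, Finsupp.single_apply]

/-- An ideal containing the differences of squares of variables and the Eulerian binomials contains
the differences of monomials with the same degree and the same vertex parities. -/
lemma monomial_sub_monomial_mem_of_eulerian {K : Type*} [Field K] {G : SimpleGraph (Fin n)}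
    [Fintype G.edgeSet] {I : Ideal (MvPolynomial G.edgeSet K)}
    (hsq : ∀ e l, X e ^ 2 - X l ^ 2 ∈ I)
    (hE : ∀ J L : Finset G.edgeSet, IsEulerianSet G (J ∪ L) → Disjoint J L → J.card = L.card →
      tMon K G J - tMon K G L ∈ I)
    {a b : G.edgeSet →₀ ℕ} (hdeg : ∑ e, a e = ∑ e, b e)
    (hpar : ∀ i, ∑ e : G.edgeSet, (a e : ZMod 2) * (if i ∈ e.1 then 1 else 0) =
      ∑ e : G.edgeSet, (b e : ZMod 2) * (if i ∈ e.1 then 1 else 0)) :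
    monomial a (1 : K) - monomial b 1 ∈ I := by
  wlog hle : #{e | a e % 2 = 0 ∧ b e % 2 = 1} ≤ #{e | a e % 2 = 1 ∧ b e % 2 = 0} generalizing a b
  · rw [← neg_sub]
    have hcomm : ∀ c d : G.edgeSet →₀ ℕ,
        #{e | c e % 2 = 0 ∧ d e % 2 = 1} = #{e | d e % 2 = 1 ∧ c e % 2 = 0} := fun c d =>
      congrArg Finset.card (Finset.filter_congr fun e _ => and_comm)
    refine I.neg_mem (this hdeg.symm (fun i => (hpar i).symm) ?_)
    rw [hcomm b a, ← hcomm a b]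
    exact (not_le.1 hle).le
  set A : Finset G.edgeSet := {e | a e % 2 = 1 ∧ b e % 2 = 0} with hA
  set B : Finset G.edgeSet := {e | a e % 2 = 0 ∧ b e % 2 = 1} with hB
  have hAB : Disjoint A B := Finset.disjoint_left.2 fun e => by simp +contextual [A, B]
  have hsum : ∀ w : G.edgeSet → ZMod 2,
      ∑ e ∈ A ∪ B, w e = ∑ e, (a e : ZMod 2) * w e + ∑ e, (b e : ZMod 2) * w e := fun w => by
    have hw : ∀ e, (a e : ZMod 2) * w e + b e * w e = if e ∈ A ∪ B then w e else 0 := fun e => by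
      have hmem : e ∈ A ∪ B ↔ (a e + b e) % 2 = 1 := by
        simp only [A, B, Finset.mem_union, Finset.mem_filter, Finset.mem_univ, true_and]
        omega
      rw [← add_mul, ← Nat.cast_add, ← ZMod.natCast_mod]
      split_ifs with h
      · rw [hmem.1 h, Nat.cast_one, one_mul]
      · rw [Nat.mod_two_ne_one.1 (mt hmem.2 h), Nat.cast_zero, zero_mul]
    rw [← Finset.sum_add_distrib, Finset.sum_congr rfl fun e _ => hw e, Finset.sum_ite_mem,
      Finset.univ_inter]
  have hcard : Even (A.card + B.card) := by
    rw [← Finset.card_union_of_disjoint hAB, ← ZMod.natCast_eq_zero_iff_even]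
    have h := hsum 1
    simp only [Pi.one_apply, mul_one, Finset.sum_const, nsmul_eq_mul, ← Nat.cast_sum, hdeg] at h
    rw [h, CharTwo.add_self_eq_zero]
  have hEul : IsEulerianSet G (A ∪ B) := fun i => by
    rw [← ZMod.natCast_eq_zero_iff_even, degIn, Finset.natCast_card_filter, hsum, hpar,
      CharTwo.add_self_eq_zero]
  obtain ⟨M, hMA, hM⟩ := Finset.exists_subset_card_eq
    (show (A.card - B.card) / 2 ≤ A.card by omega)
  have hMB : Disjoint B M := (hAB.mono_left hMA).symm
  have hJLcard : (A \ M).card = (B ∪ M).card := by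
    rw [Finset.card_sdiff_of_subset hMA, Finset.card_union_of_disjoint hMB, hM]
    have := Nat.even_iff.1 hcard
    omega
  have hJL : tMon K G (A \ M) - tMon K G (B ∪ M) ∈ I := by
    refine hE _ _ ?_ ?_ hJLcard
    · rwa [Finset.union_left_comm, Finset.sdiff_union_of_subset hMA, Finset.union_comm]
    · exact Finset.disjoint_union_right.2
        ⟨hAB.mono_left Finset.sdiff_subset, Finset.sdiff_disjoint⟩
  set u : G.edgeSet →₀ ℕ := ∑ e ∈ A \ M, Finsupp.single e 1 with hu
  set v : G.edgeSet →₀ ℕ := ∑ e ∈ B ∪ M, Finsupp.single e 1 with hv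
  have hua : u ≤ a := fun e => by
    rw [hu, sum_single_one_apply]
    split_ifs with h
    · have := (Finset.mem_filter.1 (Finset.mem_sdiff.1 h).1).2
      omega
    · exact Nat.zero_le _
  have hsplit : monomial a (1 : K) - monomial b 1 =
      monomial (a - u) 1 * (tMon K G (A \ M) - tMon K G (B ∪ M)) +
        (monomial (a - u + v) 1 - monomial b 1) := by
    rw [tMon_eq_monomial, tMon_eq_monomial, mul_sub, monomial_mul, monomial_mul, one_mul,
      ← hu, ← hv, tsub_add_cancel_of_le hua]
    ring
  rw [hsplit]
  refine I.add_mem (I.mul_mem_left _ hJL) (monomial_sub_monomial_mem_of_sq hsq ?_ fun e => ?_)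
  · have hucard : ∑ e, u e = (A \ M).card := by
      simp_rw [hu, sum_single_one_apply, Finset.sum_boole, Finset.filter_univ_mem, Nat.cast_id]
    have hvcard : ∑ e, v e = (B ∪ M).card := by
      simp_rw [hv, sum_single_one_apply, Finset.sum_boole, Finset.filter_univ_mem, Nat.cast_id]
    have h : ∑ e, (a - u) e + ∑ e, u e = ∑ e, a e := by
      rw [← Finset.sum_add_distrib]
      exact Finset.sum_congr rfl fun e _ => tsub_add_cancel_of_le (hua e)
    simp only [Finsupp.add_apply, Finset.sum_add_distrib]
    omega
  · have hue := sum_single_one_apply (A \ M) e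
    have hve := sum_single_one_apply (B ∪ M) e
    have hle := hua e
    have hmA : e ∈ A ↔ a e % 2 = 1 ∧ b e % 2 = 0 := by simp [hA]
    have hmB : e ∈ B ↔ a e % 2 = 0 ∧ b e % 2 = 1 := by simp [hB]
    have hmM := @hMA e
    simp only [← hu, Finset.mem_sdiff] at hue
    simp only [← hv, Finset.mem_union] at hve
    rw [Finsupp.add_apply, Finsupp.tsub_apply]
    grind

/-- `I(G)` is generated by the binomials `t_e² − t_ℓ²` together with all
Eulerian binomials `t_J − t_K`, where `C = J ⊔ K` is a partition of an even cardinality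
Eulerian set `C` into two sets of equal cardinality. -/
theorem stmt14 {n : ℕ} (K : Type*) [Field K] (G : SimpleGraph (Fin n))
    (hE : 2 ≤ G.edgeSet.ncard) :
    eulerianIdeal K G = Ideal.span
      ({f : MvPolynomial G.edgeSet K | ∃ e l : G.edgeSet, f = X e ^ 2 - X l ^ 2} ∪
        {f : MvPolynomial G.edgeSet K | ∃ C J K' : Finset G.edgeSet,
          IsEulerianSet G C ∧ Even C.card ∧ Disjoint J K' ∧ J ∪ K' = C ∧
          J.card = K'.card ∧ f = tMon K G J - tMon K G K'}) := by
  apply le_antisymm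
  · intro f hf
    have := Fintype.ofFinite G.edgeSet
    refine mem_of_map_eq_zero_of_monomial_sub_mem (parityMap_phiG_monomial K G)
      (fun a b hab => ?_) (parityMap_eq_zero hf)
    refine monomial_sub_monomial_mem_of_eulerian
      (fun e l => Ideal.subset_span (Or.inl ⟨e, l, rfl⟩)) (fun J L hC hJL hcard => ?_) ?_
      fun i => ?_
    · refine Ideal.subset_span (Or.inr ⟨J ∪ L, J, L, hC, ?_, hJL, rfl, hcard, rfl⟩)
      rw [Finset.card_union_of_disjoint hJL, hcard]
      exact Even.add_self _
    · simpa [Finsupp.sum_fintype, edgeClass, Prod.fst_sum, ← Finset.sum_mul] using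
        congrArg Prod.fst hab
    · simpa [Finsupp.sum_fintype, edgeClass, Prod.snd_sum] using
        congrFun (congrArg Prod.snd hab) i
  · rw [Ideal.span_le]
    rintro _ (⟨e, l, rfl⟩ | ⟨_, J, L, hC, -, hJL, rfl, hcard, rfl⟩)
    · exact sq_sub_sq_mem_eulerianIdeal K G e l
    · exact tMon_sub_tMon_mem_eulerianIdeal K hC hJL hcard
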